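/- arXiv:2401.15642 — 2 statements merged into one kernel-verified Lean document; each statement's English description precedes it below -/
import Mathlib

section
/- Let n ≥ 5 and let π be a nonidentity element of the alternating group alternatingGroup (Fin n). Then the conjugation action of alternatingGroup (Fin n) on the conjugacy class of π in alternatingGroup (Fin n) is primitive if and only if n ≥ 12, 4 ∣ n, and π is a fixed-point-free involution (a product of n/2 disjoint transpositions). -/
/-- The conjugation action of a subgroup `H ≤ G` on a subset `C ⊆ G` (closed under
conjugation by elements of `H`) is *primitive*: it is transitive, and every
equivalence relation on `C` invariant under conjugation by elements of `H` is either
the equality relation or the full relation. -/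
def IsPrimitiveConjActionOf {G : Type*} [Group G] (H : Subgroup G) (C : Set G) : Prop :=
  (∀ x ∈ C, ∀ y ∈ C, ∃ g ∈ H, g * x * g⁻¹ = y) ∧
  ∀ r : G → G → Prop,
    (∀ x ∈ C, r x x) →
    (∀ x ∈ C, ∀ y ∈ C, r x y → r y x) →
    (∀ x ∈ C, ∀ y ∈ C, ∀ z ∈ C, r x y → r y z → r x z) →
    (∀ g ∈ H, ∀ x ∈ C, ∀ y ∈ C, r x y → r (g * x * g⁻¹) (g * y * g⁻¹)) →
    (∀ x ∈ C, ∀ y ∈ C, (r x y ↔ x = y)) ∨ (∀ x ∈ C, ∀ y ∈ C, r x y)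

open Equiv Equiv.Perm Pointwise in
theorem exists_avoid {n : ℕ} (s : Finset (Fin n)) (h : s.card < n) : ∃ x, x ∉ s := by
  by_contra hc
  push Not at hc
  have : s = Finset.univ := by ext; simp [hc]
  rw [this] at h
  simp at h

open Equiv Equiv.Perm Pointwise in
theorem swaps_even {n : ℕ} {a b c d : Fin n} (h : a ≠ b) (h' : c ≠ d) :
    swap a b * swap c d ∈ alternatingGroup (Fin n) := by
  rw [mem_alternatingGroup, Perm.sign_mul, sign_swap h, sign_swap h']; rfl

open Equiv Equiv.Perm Pointwise in
theorem alt_le_of_centralizer {n : ℕ} (hn : 12 ≤ n) (π : Perm (Fin n))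
    (h2 : ∀ x, π (π x) = x) (hf : ∀ x, π x ≠ x) (K : Subgroup (Perm (Fin n)))
    (hK : ∀ g ∈ alternatingGroup (Fin n), g * π = π * g → g ∈ K)
    (g : Perm (Fin n)) (hg : g ∈ K) (hgπ : g * π * g⁻¹ ≠ π) :
    alternatingGroup (Fin n) ≤ K := by
  have hinj : ∀ x y, π x = π y → x = y := fun x y h => π.injective h
  have hA : ∀ x y, y ≠ x → y ≠ π x → swap x (π x) * swap y (π y) ∈ K := by
    intro x y h1 h3
    refine hK _ (swaps_even (hf x).symm (hf y).symm) ?_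
    ext1 z
    simp only [coe_mul, Function.comp, swap_apply_def]
    have := h2 x; have := h2 y; have := h2 z
    have := hf x; have := hf y
    have := hinj x y; have := hinj z x; have := hinj z y
    grind
  have hB : ∀ x y, y ≠ x → y ≠ π x → swap x y * swap (π x) (π y) ∈ K := by
    intro x y h1 h3
    refine hK _ (swaps_even h1.symm (fun h => h1 (hinj _ _ h).symm)) ?_
    ext1 z
    simp only [coe_mul, Function.comp, swap_apply_def]
    have := h2 x; have := h2 y; have := h2 z
    have := hf x; have := hf y
    have := hinj x y; have := hinj z x; have := hinj z y
    grind
  -- fix `a`, move `b` to `c`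
  have hC : ∀ a b c, b ≠ a → b ≠ π a → c ≠ a → c ≠ π a → ∃ k ∈ K, k a = a ∧ k b = c := by
    intro a b c h1 h3 h4 h5
    have ha := h2 a; have hb := h2 b; have hc := h2 c
    by_cases hcb : c = b
    · exact ⟨1, K.one_mem, rfl, by simp [hcb]⟩
    by_cases hcb' : c = π b
    · obtain ⟨d, hd⟩ := exists_avoid ({a, π a, b, π b} : Finset (Fin n))
        (lt_of_le_of_lt Finset.card_le_four (by omega))
      simp only [Finset.mem_insert, Finset.mem_singleton, not_or] at hd
      refine ⟨_, hA b d (by tauto) (by tauto), ?_, ?_⟩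
      · simp only [coe_mul, Function.comp, swap_apply_def]
        have := h2 d
        grind
      · simp only [coe_mul, Function.comp, swap_apply_def]
        have := h2 d
        grind
    · refine ⟨_, hB b c hcb hcb', ?_, ?_⟩
      · simp only [coe_mul, Function.comp, swap_apply_def]
        grind
      · simp only [coe_mul, Function.comp, swap_apply_def]
        have := hf b
        grind
  have hT : ∀ a b, ∃ k ∈ K, k a = b := by
    intro a b
    obtain ⟨d, hd⟩ := exists_avoid ({a, π a, b, π b} : Finset (Fin n))
        (lt_of_le_of_lt Finset.card_le_four (by omega))
    simp only [Finset.mem_insert, Finset.mem_singleton, not_or] at hd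
    obtain ⟨k, hk, _, h⟩ := hC d a b (by tauto) (by have := h2 d; grind)
      (by tauto) (by have := h2 d; grind)
    exact ⟨k, hk, h⟩
  -- three cycle
  obtain ⟨t, htK, ht3⟩ : ∃ t ∈ K, IsThreeCycle t := by
    obtain ⟨a, ha⟩ : ∃ a, (g * π * g⁻¹) a ≠ π a := by
      by_contra hc
      push Not at hc
      exact hgπ (Equiv.ext hc)
    set ρ := g * π * g⁻¹ with hρ
    have r2 : ∀ x, ρ (ρ x) = x := by intro x; simp [hρ, h2]
    have rf : ∀ x, ρ x ≠ x := by
      intro x h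
      apply hf (g⁻¹ x)
      apply g.injective
      simpa [hρ] using h
    have hR : ∀ x y, y ≠ x → y ≠ ρ x → swap x (ρ x) * swap y (ρ y) ∈ K := by
      intro x y h1 h3
      have := hA (g⁻¹ x) (g⁻¹ y) (fun h => h1 (g⁻¹.injective h)) (fun h => h3 (by
        rw [hρ]; simp only [coe_mul, Function.comp]; rw [← h]; simp))
      have := K.mul_mem (K.mul_mem hg this) (K.inv_mem hg)
      convert this using 1
      have e : ∀ u v : Fin n, swap (g u) (g v) = g * swap u v * g⁻¹ := fun u v => by
        rw [swap_apply_apply]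
      have e1 := e (g⁻¹ x) (π (g⁻¹ x))
      have e2 := e (g⁻¹ y) (π (g⁻¹ y))
      have e3 : ∀ x, g (π (g⁻¹ x)) = ρ x := fun x => by simp [hρ]
      have e4 : ∀ x, g (g⁻¹ x) = x := fun x => by simp
      rw [e3, e4] at e1 e2
      rw [e1, e2]
      group
    obtain ⟨e, he⟩ := exists_avoid ({a, π a, ρ a, π (ρ a)} : Finset (Fin n))
        (lt_of_le_of_lt Finset.card_le_four (by omega))
    simp only [Finset.mem_insert, Finset.mem_singleton, not_or] at he
    obtain ⟨f, hff⟩ := exists_avoid ({a, ρ a} ∪ {π a, ρ (π a)} ∪ {e, ρ e, π e, ρ (π e)} : Finset (Fin n)) (by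
        have h1 := Finset.card_le_two (a := a) (b := ρ a)
        have h3 := Finset.card_le_two (a := π a) (b := ρ (π a))
        have h4 := Finset.card_le_four (a := e) (b := ρ e) (c := π e) (d := ρ (π e))
        have h5 := Finset.card_union_le ({a, ρ a} : Finset (Fin n)) {π a, ρ (π a)}
        have h6 := Finset.card_union_le ({a, ρ a} ∪ {π a, ρ (π a)} : Finset (Fin n)) {e, ρ e, π e, ρ (π e)}
        omega)
    simp only [Finset.mem_insert, Finset.mem_singleton, Finset.mem_union, not_or] at hff
    have hu := hA a e (by tauto) (by tauto)
    have hv := hR a f (by tauto) (by tauto)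
    have := h2 a; have := h2 e; have := h2 (ρ a)
    have := r2 a; have := r2 e; have := r2 f; have := r2 (π e); have := r2 (π a)
    have := hf a; have := rf a; have := hf e; have := rf f; have := hf (ρ a)
    have c1 : Commute (swap e (π e)) (swap a (ρ a)) := by
      apply Disjoint.commute; apply disjoint_swap_swap; grind
    have c2 : Commute (swap a (π a)) (swap e (π e)) := by
      apply Disjoint.commute; apply disjoint_swap_swap; grind
    have c3 : Commute (swap a (π a)) (swap f (ρ f)) := by
      apply Disjoint.commute; apply disjoint_swap_swap; grind
    have c4 : Commute (swap e (π e)) (swap f (ρ f)) := by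
      apply Disjoint.commute; apply disjoint_swap_swap; grind
    have c5 : Commute (swap a (ρ a)) (swap f (ρ f)) := by
      apply Disjoint.commute; apply disjoint_swap_swap; grind
    refine ⟨_, K.pow_mem (K.mul_mem hu hv) 2, ?_⟩
    have e1 : swap a (π a) * swap e (π e) * (swap a (ρ a) * swap f (ρ f)) =
        (swap a (π a) * swap a (ρ a)) * (swap e (π e) * swap f (ρ f)) := by
      simp only [mul_assoc]
      rw [← mul_assoc (swap e (π e)), c1.eq, mul_assoc]
    rw [e1, Commute.mul_pow]
    · rw [c4.mul_pow, pow_two (swap e _), pow_two (swap f _), swap_mul_self, swap_mul_self,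
        one_mul, mul_one, pow_two]
      exact (isThreeCycle_swap_mul_swap_same (by grind) (by grind) (by grind)).isThreeCycle_sq
    · exact (c2.mul_right c3).mul_left (c1.symm.mul_right c5)
  have hbig : ∀ B : Set (Fin n), MulAction.IsBlock K B → ∀ a ∈ B, ∀ b ∈ B, b ≠ a → b ≠ π a →
      B = Set.univ := by
    intro B hB a ha b hb h1 h3
    have key : ∀ a ∈ B, ∀ b ∈ B, b ≠ a → b ≠ π a → ∀ c, c ≠ π a → c ∈ B := by
      intro a ha b hb h1 h3 c hc
      by_cases hca : c = a
      · rwa [hca]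
      obtain ⟨k, hk, k1, k2⟩ := hC a b c h1 h3 hca hc
      have := hB.smul_eq_of_mem (g := ⟨k, hk⟩) ha (by
        change k a ∈ B
        rwa [k1])
      rw [← this]
      exact ⟨b, hb, k2⟩
    ext c
    simp only [Set.mem_univ, iff_true]
    by_cases hc : c = π a
    · apply key b hb a ha h1.symm (by have := h2 b; grind)
      have := hinj a b
      grind
    · exact key a ha b hb h1 h3 c hc
  have hprim : MulAction.IsPreprimitive K (Fin n) := by
    refine { exists_smul_eq := ?_, isTrivialBlock_of_isBlock := ?_ }
    · intro a b
      obtain ⟨k, hk, h⟩ := hT a b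
      exact ⟨⟨k, hk⟩, h⟩
    · intro B hB
      by_contra hc
      simp only [MulAction.IsTrivialBlock, not_or, Set.not_subsingleton_iff] at hc
      obtain ⟨⟨a, ha, b, hb, hab⟩, hu⟩ := hc
      have hpair : ∀ k : K, ∀ x ∈ k • B, ∀ y ∈ k • B, y ≠ x → y = π x := by
        intro k x hx y hy hxy
        by_contra h3
        have := hbig _ (hB.translate k) x hx y hy hxy h3
        apply hu
        rw [smul_eq_iff_eq_inv_smul] at this
        rw [this]; simp
      have hba : b = π a := hpair 1 a (by simpa using ha) b (by simpa using hb) hab.symm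
      apply hgπ
      have : ∀ x, g (π x) = π (g x) := by
        intro x
        obtain ⟨k, hk, h⟩ := hT a x
        have h4 : k b = π x := by
          rw [← h]
          exact hpair ⟨k, hk⟩ (k a) ⟨a, ha, rfl⟩ (k b) ⟨b, hb, rfl⟩ (fun h => hab (k.injective h).symm)
        have h5 := hpair ⟨g * k, K.mul_mem hg hk⟩ (g (k a)) ⟨a, ha, rfl⟩ (g (k b)) ⟨b, hb, rfl⟩
          (fun h => hab (k.injective (g.injective h)).symm)
        rw [h4, h] at h5
        exact h5
      rw [mul_inv_eq_iff_eq_mul]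
      exact Equiv.ext this
  exact alternatingGroup_le_of_isPreprimitive_of_isThreeCycle_mem hprim ht3 htK

theorem inv_app' {α : Type*} (g : Equiv.Perm α) (x : α) : g⁻¹ (g x) = x := g.symm_apply_apply x

def tab8 (a b c d : Fin 8) : Fin 8 → Fin 8 :=
  ![a, a ^^^ 1, b, b ^^^ 1, c, c ^^^ 1, d, d ^^^ 1]

def sgn8 (f : Fin 8 → Fin 8) : ℤˣ := ∏ j, ∏ i ∈ Finset.Iio j, if f i < f j then (1 : ℤˣ) else -1

set_option maxRecDepth 100000 in
theorem tab8_spec : ∀ a b : Fin 8, b ≠ a → b ≠ a ^^^ 1 →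
    ∀ c : Fin 8, c ≠ a → c ≠ a ^^^ 1 → c ≠ b → c ≠ b ^^^ 1 →
    ∀ d : Fin 8, d ≠ a → d ≠ a ^^^ 1 → d ≠ b → d ≠ b ^^^ 1 → d ≠ c → d ≠ c ^^^ 1 →
    (sgn8 (tab8 a b c d) ≠ 1 ∨ a ^^^ b ^^^ c ^^^ d = 0) := by
  decide +kernel

theorem lin8 : ∀ a b c d : Fin 8, (a ^^^ b ^^^ c ^^^ d = 0) → ∀ v i,
    tab8 a b c d (i ^^^ v) = tab8 a b c d i ^^^ (tab8 a b c d v ^^^ a) := by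
  decide +kernel

theorem aff8 (g : Equiv.Perm (Fin 8)) (hg : g ∈ alternatingGroup (Fin 8))
    (h : ∀ i, g (i ^^^ 1) = g i ^^^ 1) : ∀ v i, g (i ^^^ v) = g i ^^^ (g v ^^^ g 0) := by
  have e : (g : Fin 8 → Fin 8) = tab8 (g 0) (g 2) (g 4) (g 6) := by
    funext i
    fin_cases i
    · rfl
    · exact h 0
    · rfl
    · exact h 2
    · rfl
    · exact h 4
    · rfl
    · exact h 6
  have hi : ∀ i j, i ≠ j → g i ≠ g j := fun i j => g.injective.ne
  have key := tab8_spec (g 0) (g 2) (hi _ _ (by decide)) (by rw [← h]; exact hi _ _ (by decide))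
    (g 4) (hi _ _ (by decide)) (by rw [← h]; exact hi _ _ (by decide))
    (hi _ _ (by decide)) (by rw [← h]; exact hi _ _ (by decide))
    (g 6) (hi _ _ (by decide)) (by rw [← h]; exact hi _ _ (by decide))
    (hi _ _ (by decide)) (by rw [← h]; exact hi _ _ (by decide))
    (hi _ _ (by decide)) (by rw [← h]; exact hi _ _ (by decide))
  rw [← e] at key
  rcases key with key | key
  · exact absurd ((Equiv.Perm.sign_eq_prod_prod_Iio g).symm.trans
      (Equiv.Perm.mem_alternatingGroup.1 hg)) key
  · intro v i
    have := lin8 _ _ _ _ key v i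
    rwa [← e] at this

theorem xor8_a : ∀ i : Fin 8, i ^^^ 0 = i := by decide
theorem xor8_c : ∀ i u : Fin 8, i ^^^ u = i → u = 0 := by decide

def sing8 : Equiv.Perm (Fin 8) where
  toFun := ![0, 2, 4, 6, 3, 1, 7, 5]
  invFun := ![0, 5, 1, 4, 2, 7, 3, 6]
  left_inv := by decide
  right_inv := by decide

theorem sing8_lin : ∀ i j : Fin 8, sing8 (i ^^^ j) = sing8 i ^^^ sing8 j := by decide

theorem sing8_even : sing8 ∈ alternatingGroup (Fin 8) := by
  rw [Equiv.Perm.mem_alternatingGroup]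
  have h : sing8 ^ 7 = 1 := by ext i; revert i; decide
  have h2 := congrArg Equiv.Perm.sign h
  rw [map_pow, map_one] at h2
  rcases Int.units_eq_one_or (Equiv.Perm.sign sing8) with h3 | h3
  · exact h3
  · rw [h3] at h2; exact absurd h2 (by decide)

theorem lin8_exists (v : Fin 8) (hv : v ≠ 0) : ∃ l ∈ alternatingGroup (Fin 8),
    (∀ i j, l (i ^^^ j) = l i ^^^ l j) ∧ l 1 = v := by
  have h1 : ∀ v : Fin 8, v ≠ 0 → ∃ k : Fin 7, (sing8 ^ (k : ℕ)) 1 = v := by decide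
  obtain ⟨k, hk⟩ := h1 v hv
  refine ⟨_, Subgroup.pow_mem _ sing8_even k, ?_, hk⟩
  generalize (k : ℕ) = m
  induction m with
  | zero => intro i j; rfl
  | succ m ih => intro i j; rw [pow_succ']; simp only [Equiv.Perm.coe_mul, Function.comp, ih, sing8_lin]

def BB (x : Equiv.Perm (Fin 8)) : Prop := ∃ v, v ≠ 0 ∧ ∀ i, x i = i ^^^ v

theorem BB_block (g x y : Equiv.Perm (Fin 8)) (hg : g ∈ alternatingGroup (Fin 8)) (hx : BB x)
    (hgx : BB (g * x * g⁻¹)) (hy : BB y) : BB (g * y * g⁻¹) := by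
  obtain ⟨v, hv, hxv⟩ := hx
  obtain ⟨w, hw, hgw⟩ := hgx
  obtain ⟨u, hu, hyu⟩ := hy
  have h1 : ∀ i, g (i ^^^ v) = g i ^^^ w := by
    intro i
    have := hgw (g i)
    simpa [hxv] using this
  obtain ⟨l, hl, ll, l1⟩ := lin8_exists v hv
  obtain ⟨m, hm, ml, m1⟩ := lin8_exists w hw
  have hh := Subgroup.mul_mem _ (Subgroup.mul_mem _ (Subgroup.inv_mem _ hm) hg) hl
  obtain ⟨h, rfl⟩ : ∃ h, g = m * h * l⁻¹ := ⟨m⁻¹ * g * l, by group⟩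
  have e : m⁻¹ * (m * h * l⁻¹) * l = h := by group
  rw [e] at hh
  have haff := aff8 h hh (by
    intro i
    apply m.injective
    have := h1 (l i)
    rw [← l1, ← ll] at this
    simp only [Equiv.Perm.coe_mul, Function.comp, inv_app'] at this
    rw [ml, m1, this])
  have h2 : ∀ i, (m * h * l⁻¹) (i ^^^ u) = (m * h * l⁻¹) i ^^^ m (h (l⁻¹ u) ^^^ h 0) := by
    intro i
    obtain ⟨i, rfl⟩ := l.surjective i
    obtain ⟨u, rfl⟩ := l.surjective u
    rw [← ll]
    simp only [Equiv.Perm.coe_mul, Function.comp, inv_app']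
    rw [haff, ml]
  refine ⟨m (h (l⁻¹ u) ^^^ h 0), ?_, ?_⟩
  · intro h0
    have := h2 0
    rw [h0, xor8_a] at this
    exact hu (xor8_c _ _ ((m * h * l⁻¹).injective this))
  · intro i
    obtain ⟨i, rfl⟩ := (m * h * l⁻¹).surjective i
    rw [← h2]
    simp [hyu]

open Equiv Equiv.Perm in
theorem fpf_cycleType {n : ℕ} (hn : 0 < n) (x : Perm (Fin n)) (h2 : x ^ 2 = 1) (hf : ∀ i, x i ≠ i) :
    ∃ k, n = 2 * k ∧ x.cycleType = Multiset.replicate k 2 := by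
  have ho : orderOf x = 2 := orderOf_eq_prime h2 (by rintro rfl; exact hf ⟨0, hn⟩ rfl)
  obtain ⟨k, hk⟩ := cycleType_prime_order (σ := x) (by rw [ho]; exact Nat.prime_two)
  rw [ho] at hk
  refine ⟨k + 1, ?_, hk⟩
  have hs : x.support = Finset.univ := by ext i; simp [hf]
  have := sum_cycleType x
  rw [hs, hk] at this
  simp at this
  omega

open Equiv Equiv.Perm in
theorem fpf_conj {n : ℕ} (hn : 0 < n) (x y : Perm (Fin n)) (h2 : x ^ 2 = 1) (hf : ∀ i, x i ≠ i)
    (h2' : y ^ 2 = 1) (hf' : ∀ i, y i ≠ i) :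
    ∃ g ∈ alternatingGroup (Fin n), g * x * g⁻¹ = y := by
  obtain ⟨k, hk, hx⟩ := fpf_cycleType hn x h2 hf
  obtain ⟨k', hk', hy⟩ := fpf_cycleType hn y h2' hf'
  obtain rfl : k = k' := by omega
  obtain ⟨g, hg⟩ := isConj_iff.1 (isConj_iff_cycleType_eq.2 (hx.trans hy.symm))
  rcases Int.units_eq_one_or (sign g) with h | h
  · exact ⟨g, h, hg⟩
  · let a : Fin n := ⟨0, hn⟩
    refine ⟨swap a (y a) * g, ?_, ?_⟩
    · rw [mem_alternatingGroup, Perm.sign_mul, h, sign_swap (hf' a).symm]; rfl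
    · have e : y * swap a (y a) = swap a (y a) * y := by
        rw [mul_swap_eq_swap_mul, swap_comm]
        congr 2
        change (y * y) a = a
        rw [← pow_two, h2']; rfl
      rw [mul_inv_rev]
      calc _ = swap a (y a) * (g * x * g⁻¹) * (swap a (y a))⁻¹ := by group
        _ = y := by rw [hg, ← e]; simp

def T8 (v : Fin 8) : Equiv.Perm (Fin 8) where
  toFun i := i ^^^ v
  invFun i := i ^^^ v
  left_inv := by intro i; revert i v; decide
  right_inv := by intro i; revert i v; decide

def U8 : Equiv.Perm (Fin 8) where
  toFun := ![1, 0, 3, 2, 6, 7, 4, 5]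
  invFun := ![1, 0, 3, 2, 6, 7, 4, 5]
  left_inv := by decide
  right_inv := by decide


theorem not_prim8 (π : Equiv.Perm (Fin 8)) (h2 : π ^ 2 = 1) (hf : ∀ x, π x ≠ x)
    (hp : IsPrimitiveConjActionOf (alternatingGroup (Fin 8))
        {σ : Equiv.Perm (Fin 8) | ∃ g ∈ alternatingGroup (Fin 8), g * π * g⁻¹ = σ}) : False := by
  have hT : ∀ v ≠ 0, T8 v ^ 2 = 1 ∧ ∀ i, T8 v i ≠ i := by
    intro v hv
    constructor
    · ext1 i; revert i v; decide
    · intro i; revert i v; decide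
  have hU : U8 ^ 2 = 1 ∧ ∀ i, U8 i ≠ i := by
    constructor
    · ext1 i; revert i; decide
    · decide
  have hC : ∀ y : Equiv.Perm (Fin 8), y ^ 2 = 1 ∧ (∀ i, y i ≠ i) →
      y ∈ {σ : Equiv.Perm (Fin 8) | ∃ g ∈ alternatingGroup (Fin 8), g * π * g⁻¹ = σ} :=
    fun y hy => fpf_conj (by norm_num) π y h2 hf hy.1 hy.2
  have hBT : ∀ v ≠ 0, BB (T8 v) := fun v hv => ⟨v, hv, fun i => rfl⟩
  have h10 : (1 : Fin 8) ≠ 0 := by decide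
  have h20 : (2 : Fin 8) ≠ 0 := by decide
  refine (hp.2 (fun x y => ∃ g ∈ alternatingGroup (Fin 8), BB (g * x * g⁻¹) ∧ BB (g * y * g⁻¹))
    ?_ ?_ ?_ ?_).elim (fun h => ?_) (fun h => ?_)
  · rintro x ⟨k, hk, rfl⟩
    obtain ⟨g, hg, hgx⟩ := fpf_conj (by norm_num) π (T8 1) h2 hf (hT 1 h10).1 (hT 1 h10).2
    have e : g * k⁻¹ * (k * π * k⁻¹) * (g * k⁻¹)⁻¹ = T8 1 := by rw [← hgx]; group
    have hB : BB (g * k⁻¹ * (k * π * k⁻¹) * (g * k⁻¹)⁻¹) := by rw [e]; exact hBT 1 h10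
    exact ⟨g * k⁻¹, Subgroup.mul_mem _ hg (Subgroup.inv_mem _ hk), hB, hB⟩
  · rintro x - y - ⟨g, hg, h, h'⟩
    exact ⟨g, hg, h', h⟩
  · rintro x - y - z - ⟨g, hg, hx, hy⟩ ⟨k, hk, hy', hz⟩
    refine ⟨k, hk, ?_, hz⟩
    have e : ∀ s : Equiv.Perm (Fin 8), k * g⁻¹ * (g * s * g⁻¹) * (k * g⁻¹)⁻¹ = k * s * k⁻¹ := by
      intro s; group
    have := BB_block (k * g⁻¹) (g * y * g⁻¹) (g * x * g⁻¹)
      (Subgroup.mul_mem _ hk (Subgroup.inv_mem _ hg)) hy (by rw [e]; exact hy') hx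
    rwa [e] at this
  · rintro k hk x - y - ⟨g, hg, hx, hy⟩
    have e : ∀ s : Equiv.Perm (Fin 8), g * k⁻¹ * (k * s * k⁻¹) * (g * k⁻¹)⁻¹ = g * s * g⁻¹ := by
      intro s; group
    refine ⟨g * k⁻¹, Subgroup.mul_mem _ hg (Subgroup.inv_mem _ hk), ?_, ?_⟩
    · rw [e]; exact hx
    · rw [e]; exact hy
  · have := (h _ (hC _ (hT 1 h10)) _ (hC _ (hT 2 h20))).1
      ⟨1, Subgroup.one_mem _, by simpa using hBT 1 h10, by simpa using hBT 2 h20⟩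
    exact absurd (congrArg (fun s : Equiv.Perm (Fin 8) => s 0) this) (by decide)
  · obtain ⟨g, -, ⟨v, hv, hgv⟩, ⟨w, hw, hgw⟩⟩ := h _ (hC _ (hT 1 h10)) _ (hC _ hU)
    have a1 := hgv (g 0)
    have a2 := hgw (g 0)
    have a3 := hgv (g 4)
    have a4 := hgw (g 4)
    simp only [Equiv.Perm.coe_mul, Function.comp, inv_app'] at a1 a2 a3 a4
    have b1 : T8 1 0 = 1 := by decide
    have b2 : U8 0 = 1 := by decide
    have b3 : T8 1 4 = 5 := by decide
    have b4 : U8 4 = 6 := by decide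
    rw [b1] at a1; rw [b2] at a2; rw [b3] at a3; rw [b4] at a4
    have hx : ∀ a v w : Fin 8, a ^^^ v = a ^^^ w → v = w := by decide
    have hvw := hx _ _ _ (a1.symm.trans a2)
    rw [hvw, ← a4] at a3
    exact absurd (g.injective a3) (by decide)


open Equiv Equiv.Perm in
theorem forward_sq {n : ℕ} (hn : 5 ≤ n) (π : Perm (Fin n))
    (hπA : π ∈ alternatingGroup (Fin n)) (hπ1 : π ≠ 1)
    (hp : IsPrimitiveConjActionOf (alternatingGroup (Fin n))
        {σ : Equiv.Perm (Fin n) | ∃ g ∈ alternatingGroup (Fin n), g * π * g⁻¹ = σ}) :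
    ∀ a, π (π a) = a := by
  have hC1 : π ∈ {σ : Equiv.Perm (Fin n) | ∃ g ∈ alternatingGroup (Fin n), g * π * g⁻¹ = σ} :=
    ⟨1, Subgroup.one_mem _, by simp⟩
  have hCg : ∀ g ∈ alternatingGroup (Fin n), g * π * g⁻¹ ∈
      {σ : Equiv.Perm (Fin n) | ∃ g ∈ alternatingGroup (Fin n), g * π * g⁻¹ = σ} :=
    fun g hg => ⟨g, hg, rfl⟩
  rcases hp.2 (fun x y => ∀ p q, x.SameCycle p q ↔ y.SameCycle p q)
    (fun x _ p q => Iff.rfl) (fun x _ y _ h p q => (h p q).symm)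
    (fun x _ y _ z _ h h' p q => (h p q).trans (h' p q))
    (fun g _ x _ y _ h p q => by rw [sameCycle_conj, sameCycle_conj]; exact h _ _) with h | h
  · -- equality
    have key : ∀ g ∈ alternatingGroup (Fin n),
        (∀ p q, π.SameCycle (g p) (g q) ↔ π.SameCycle p q) → ∀ x, g (π x) = π (g x) := by
      intro g hg hs
      have := (h _ hC1 _ (hCg g hg)).1 (fun p q => by
        rw [sameCycle_conj, ← hs (g⁻¹ p)]; simp)
      intro x
      have h3 : (g * π * g⁻¹) (g x) = π (g x) := by rw [← this]
      simpa using h3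
    have hsw : ∀ x y, π.SameCycle x y → ∀ p, π.SameCycle p (swap x y p) := by
      intro x y hxy p
      rw [swap_apply_def]
      split_ifs with h1 h3
      · rwa [h1]
      · rw [h3]; exact hxy.symm
      · exact SameCycle.refl _ _
    have hsw' : ∀ x y, π.SameCycle x y → ∀ p q,
        π.SameCycle (swap x y p) (swap x y q) ↔ π.SameCycle p q := by
      intro x y hxy p q
      exact ⟨fun h => (hsw x y hxy p).trans (h.trans (hsw x y hxy q).symm),
        fun h => (hsw x y hxy p).symm.trans (h.trans (hsw x y hxy q))⟩
    have hfx : ∀ x y, π x = x → π y = y → ∀ p q,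
        π.SameCycle (swap x y p) (swap x y q) ↔ π.SameCycle p q := by
      intro x y hx hy p q
      have e : (swap x y) * π * (swap x y)⁻¹ = π := by
        rw [mul_inv_eq_iff_eq_mul, mul_swap_eq_swap_mul, hx, hy]
      conv_lhs => rw [← e]
      rw [sameCycle_conj]; simp
    by_contra hc
    push Not at hc
    obtain ⟨a, ha⟩ := hc
    have hinj : ∀ x y, π x = π y → x = y := fun x y h => π.injective h
    have hab : π a ≠ a := fun h => ha (by rw [h, h])
    have hbc : π (π a) ≠ π a := fun h => hab (hinj _ _ h)
    have sab : π.SameCycle a (π a) := sameCycle_apply_right.2 (SameCycle.refl _ _)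
    have sbc : π.SameCycle (π a) (π (π a)) := sameCycle_apply_right.2 (SameCycle.refl _ _)
    by_cases hd : ∃ d, π.SameCycle (π a) d ∧ d ≠ a ∧ d ≠ π a ∧ d ≠ π (π a)
    · obtain ⟨d, sd, d1, d2, d3⟩ := hd
      have := key (swap (π a) (π (π a)) * swap (π (π a)) d) (swaps_even hbc.symm d3.symm) (by
        intro p q
        simp only [coe_mul, Function.comp]
        rw [hsw' _ _ sbc, hsw' _ _ (sbc.symm.trans sd)]) a
      simp only [coe_mul, Function.comp, swap_apply_def] at this
      grind
    · push Not at hd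
      obtain ⟨d, e, hde, hs, hda, hea⟩ : ∃ d e, d ≠ e ∧ (∀ p q,
          π.SameCycle (swap d e p) (swap d e q) ↔ π.SameCycle p q) ∧
          (d ≠ a ∧ d ≠ π a ∧ d ≠ π (π a)) ∧ (e ≠ a ∧ e ≠ π a ∧ e ≠ π (π a)) := by
        by_cases hm : ∃ d, π d ≠ d ∧ (d ≠ a ∧ d ≠ π a ∧ d ≠ π (π a))
        · obtain ⟨d, hd1, hd2⟩ := hm
          refine ⟨d, π d, hd1.symm, hsw' _ _ (sameCycle_apply_right.2 (SameCycle.refl _ _)), hd2, ?_⟩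
          by_contra hcc
          have hs : π.SameCycle (π a) (π d) := by
            by_cases h1 : π d = a
            · rw [h1]; exact sab.symm
            by_cases h2 : π d = π a
            · rw [h2]
            by_cases h3 : π d = π (π a)
            · rw [h3]; exact sbc
            tauto
          exact hd2.2.2 (hd d (sameCycle_apply_right.1 hs) hd2.1 hd2.2.1)
        · push Not at hm
          obtain ⟨d, hd'⟩ := exists_avoid ({a, π a, π (π a)} : Finset (Fin n))
            (lt_of_le_of_lt Finset.card_le_three (by omega))
          obtain ⟨e, he'⟩ := exists_avoid ({a, π a, π (π a), d} : Finset (Fin n))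
            (lt_of_le_of_lt Finset.card_le_four (by omega))
          simp only [Finset.mem_insert, Finset.mem_singleton, not_or] at hd' he'
          refine ⟨d, e, fun h => he'.2.2.2 h.symm, hfx d e ?_ ?_, hd', by tauto⟩
          · by_contra h1; exact hd'.2.2 (hm d h1 hd'.1 hd'.2.1)
          · by_contra h1; exact he'.2.2.1 (hm e h1 he'.1 he'.2.1)
      have := key (swap (π a) (π (π a)) * swap d e) (swaps_even hbc.symm hde) (by
        intro p q
        simp only [coe_mul, Function.comp]
        rw [hsw' _ _ sbc, hs]) a
      simp only [coe_mul, Function.comp, swap_apply_def] at this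
      grind
  · -- full: a single cycle
    exfalso
    have hinv : ∀ g ∈ alternatingGroup (Fin n), ∀ p q, π.SameCycle p q → π.SameCycle (g p) (g q) := by
      intro g hg p q hpq
      rw [h _ hC1 _ (hCg g hg), sameCycle_conj]
      simpa using hpq
    obtain ⟨a, ha⟩ : ∃ a, π a ≠ a := by
      by_contra hc
      push Not at hc
      exact hπ1 (Equiv.ext hc)
    have sab : π.SameCycle a (π a) := sameCycle_apply_right.2 (SameCycle.refl _ _)
    have hall : ∀ c, π.SameCycle a c := by
      intro c
      by_cases h1 : c = a
      · rw [h1]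
      by_cases h3 : c = π a
      · rwa [h3]
      obtain ⟨d, hd'⟩ := exists_avoid ({a, π a, c} : Finset (Fin n))
        (lt_of_le_of_lt Finset.card_le_three (by omega))
      obtain ⟨e, he'⟩ := exists_avoid ({a, π a, c, d} : Finset (Fin n))
        (lt_of_le_of_lt Finset.card_le_four (by omega))
      simp only [Finset.mem_insert, Finset.mem_singleton, not_or] at hd' he'
      have := hinv (swap (π a) c * swap d e) (swaps_even (Ne.symm h3) (by grind)) _ _ sab
      have e1 : (swap (π a) c * swap d e) a = a := by
        simp only [coe_mul, Function.comp, swap_apply_def]; grind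
      have e2 : (swap (π a) c * swap d e) (π a) = c := by
        simp only [coe_mul, Function.comp, swap_apply_def]; grind
      rwa [e1, e2] at this
    have hcyc : π.IsCycle := ⟨a, ha, fun y _ => hall y⟩
    have hsupp : π.support = Finset.univ := by
      ext y
      simp only [mem_support, Finset.mem_univ, iff_true]
      intro hy
      exact ha (((hall y).apply_eq_self_iff).2 hy)
    have hord : orderOf π = n := by rw [hcyc.orderOf, hsupp]; simp
    have hodd : Odd n := by
      have := hcyc.sign
      rw [mem_alternatingGroup.1 hπA, hsupp, Finset.card_univ, Fintype.card_fin] at this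
      by_contra hne
      rw [Nat.not_odd_iff_even] at hne
      rw [hne.neg_one_pow] at this
      exact absurd this (by decide)
    have hcop : Nat.Coprime 2 (orderOf π) := by rw [hord]; exact Nat.coprime_two_left.2 hodd
    have hcop4 : Nat.Coprime (orderOf π) 4 := by
      have := Nat.Coprime.pow_left 2 hcop
      exact this.symm
    rcases hp.2 (fun x y => Subgroup.zpowers x = Subgroup.zpowers y)
      (fun x _ => rfl) (fun x _ y _ h => h.symm)
      (fun x _ y _ z _ h h' => h.trans h')
      (fun g _ x _ y _ h => by
        have e : ∀ x : Perm (Fin n), Subgroup.zpowers (g * x * g⁻¹) =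
            (Subgroup.zpowers x).map (MulAut.conj g).toMonoidHom := by
          intro x; rw [MonoidHom.map_zpowers]; rfl
        change Subgroup.zpowers x = Subgroup.zpowers y at h
        change Subgroup.zpowers (g * x * g⁻¹) = Subgroup.zpowers (g * y * g⁻¹)
        rw [e, e, h]) with h' | h'
    · obtain ⟨g, hg⟩ := isConj_iff.1 ((hcyc.isConj_iff (hcyc.pow_iff.2 hcop)).2
        (by rw [support_pow_coprime hcop]))
      have h4 : (g * g) * π * (g * g)⁻¹ = π ^ 4 := by
        calc _ = g * (g * π * g⁻¹) * g⁻¹ := by group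
          _ = (g * π * g⁻¹) ^ 2 := by rw [conj_pow, hg]
          _ = π ^ 4 := by rw [hg, ← pow_mul]
      have hgg : g * g ∈ alternatingGroup (Fin n) := by
        rw [mem_alternatingGroup, Perm.sign_mul]; exact Int.units_mul_self _
      have hmem := hCg _ hgg
      rw [h4] at hmem
      have hz : Subgroup.zpowers π = Subgroup.zpowers (π ^ 4) := by
        apply le_antisymm
        · rw [Subgroup.zpowers_le]
          obtain ⟨m, hm⟩ := exists_pow_eq_self_of_coprime hcop4.symm
          exact ⟨m, by simpa using hm⟩
        · rw [Subgroup.zpowers_le]; exact Subgroup.pow_mem _ (Subgroup.mem_zpowers π) 4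
      have h5 := (h' _ hC1 _ hmem).1 hz
      have h6 : π ^ 3 = 1 := by
        rw [pow_succ] at h5
        exact (mul_eq_right.1 h5.symm)
      have := Nat.le_of_dvd (by norm_num) (orderOf_dvd_of_pow_eq_one h6)
      omega
    · have hinj : ∀ x y, π x = π y → x = y := fun x y h => π.injective h
      have hbc : π (π a) ≠ π a := fun h => ha (hinj _ _ h)
      have hca : π (π a) ≠ a := by
        intro hca
        have h3 : π ^ 2 = 1 := by
          ext1 y
          obtain ⟨i, rfl⟩ := hall y
          have : (π ^ 2) a = a := by rw [pow_two]; exact hca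
          calc (π ^ 2) ((π ^ i) a) = (π ^ i) ((π ^ 2) a) := by
                rw [← Perm.mul_apply, ← Perm.mul_apply]
                congr 1
                exact ((Commute.refl π).pow_left 2).zpow_right i
            _ = _ := by rw [this]; rfl
        have := Nat.le_of_dvd (by norm_num) (orderOf_dvd_of_pow_eq_one h3)
        omega
      obtain ⟨d, hd'⟩ := exists_avoid ({a, π a, π (π a)} : Finset (Fin n))
        (lt_of_le_of_lt Finset.card_le_three (by omega))
      obtain ⟨e, he'⟩ := exists_avoid ({a, π a, π (π a), d} : Finset (Fin n))
        (lt_of_le_of_lt Finset.card_le_four (by omega))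
      simp only [Finset.mem_insert, Finset.mem_singleton, not_or] at hd' he'
      have hge : swap (π (π a)) d * swap d e ∈ alternatingGroup (Fin n) :=
        swaps_even (by tauto) (by tauto)
      have h7 := h' _ hC1 _ (hCg _ hge)
      set g := swap (π (π a)) d * swap d e with hgdef
      have g1 : g a = a := by
        simp only [hgdef, coe_mul, Function.comp, swap_apply_def]; grind
      have g2 : g (π a) = π a := by
        simp only [hgdef, coe_mul, Function.comp, swap_apply_def]; grind
      have g3 : g (π (π a)) = d := by
        simp only [hgdef, coe_mul, Function.comp, swap_apply_def]; grind
      have h8 : g * π * g⁻¹ ∈ Subgroup.zpowers π := by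
        change Subgroup.zpowers π = Subgroup.zpowers _ at h7
        rw [h7]; exact Subgroup.mem_zpowers _
      obtain ⟨k, hk⟩ := h8
      change π ^ k = _ at hk
      have k1 : (g * π * g⁻¹) (g a) = π a := by simp [g2]
      have k2 : (g * π * g⁻¹) (g (π a)) = d := by simp [g3]
      rw [g1, ← hk] at k1
      rw [g2, ← hk] at k2
      have : (π ^ k) (π a) = π ((π ^ k) a) := by
        rw [← Perm.mul_apply, ← Perm.mul_apply]
        congr 1
        exact ((Commute.refl π).zpow_left k)
      rw [k1, k2] at this
      tauto

open Equiv Equiv.Perm in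
theorem forward_fpf {n : ℕ} (hn : 5 ≤ n) (π : Perm (Fin n))
    (hπA : π ∈ alternatingGroup (Fin n)) (hπ1 : π ≠ 1) (h2 : ∀ a, π (π a) = a)
    (hp : IsPrimitiveConjActionOf (alternatingGroup (Fin n))
        {σ : Equiv.Perm (Fin n) | ∃ g ∈ alternatingGroup (Fin n), g * π * g⁻¹ = σ}) :
    ∀ a, π a ≠ a := by
  have hC1 : π ∈ {σ : Equiv.Perm (Fin n) | ∃ g ∈ alternatingGroup (Fin n), g * π * g⁻¹ = σ} :=
    ⟨1, Subgroup.one_mem _, by simp⟩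
  have hCg : ∀ g ∈ alternatingGroup (Fin n), g * π * g⁻¹ ∈
      {σ : Equiv.Perm (Fin n) | ∃ g ∈ alternatingGroup (Fin n), g * π * g⁻¹ = σ} :=
    fun g hg => ⟨g, hg, rfl⟩
  have hcf : ∀ (g x : Perm (Fin n)) p, (g * x * g⁻¹) p = p ↔ x (g⁻¹ p) = g⁻¹ p := by
    intro g x p
    simp only [coe_mul, Function.comp]
    exact (eq_inv_iff_eq (f := g)).symm
  obtain ⟨a, ha⟩ : ∃ a, π a ≠ a := by
    by_contra hc
    push Not at hc
    exact hπ1 (Equiv.ext hc)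
  rcases hp.2 (fun x y => ∀ p, x p = p ↔ y p = p)
    (fun x _ p => Iff.rfl) (fun x _ y _ h p => (h p).symm)
    (fun x _ y _ z _ h h' p => (h p).trans (h' p))
    (fun g _ x _ y _ h p => by rw [hcf, hcf]; exact h _) with h | h
  · exfalso
    obtain ⟨c, hc1, hc2, hc3⟩ : ∃ c, c ≠ a ∧ c ≠ π a ∧ π c ≠ c := by
      by_contra hc
      push Not at hc
      have e : π = swap a (π a) := by
        ext1 x
        rw [swap_apply_def]
        split_ifs with h1 h3
        · rw [h1]
        · rw [h3, h2]
        · exact hc x h1 h3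
      have hs := mem_alternatingGroup.1 hπA
      rw [e, sign_swap ha.symm] at hs
      exact absurd hs (by decide)
    have hinj : ∀ x y, π x = π y → x = y := fun x y h => π.injective h
    have hge : swap (π a) c * swap c (π c) ∈ alternatingGroup (Fin n) :=
      swaps_even (by tauto) (by tauto)
    have e1 := (h _ hC1 _ (hCg _ hge)).1 (by
      intro p
      rw [hcf]
      have := h2 a; have := h2 c
      simp only [mul_inv_rev, swap_inv, coe_mul, Function.comp, swap_apply_def]
      grind)
    have e2 : ∀ g : Perm (Fin n), π = g * π * g⁻¹ → π (g a) = g (π a) := by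
      intro g hg
      have h3 : (g * π * g⁻¹) (g a) = π (g a) := by rw [← hg]
      rw [← h3]
      simp only [Perm.mul_apply, inv_app']
    have e3 := e2 _ e1
    have h3 : a ≠ π c := fun h => hc2 (by rw [h, h2])
    have h4 : π a ≠ π c := fun h => hc1 (hinj _ _ h).symm
    rw [Perm.mul_apply, Perm.mul_apply, swap_apply_of_ne_of_ne hc1.symm h3,
      swap_apply_of_ne_of_ne ha.symm hc1.symm, swap_apply_of_ne_of_ne hc2.symm h4,
      swap_apply_left] at e3
    exact hc2 e3.symm
  · intro b hb
    have hab : a ≠ b := by rintro rfl; exact ha hb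
    obtain ⟨d, hd'⟩ := exists_avoid ({a, b} : Finset (Fin n))
      (lt_of_le_of_lt Finset.card_le_two (by omega))
    obtain ⟨e, he'⟩ := exists_avoid ({a, b, d} : Finset (Fin n))
      (lt_of_le_of_lt Finset.card_le_three (by omega))
    simp only [Finset.mem_insert, Finset.mem_singleton, not_or] at hd' he'
    have hge : swap a b * swap d e ∈ alternatingGroup (Fin n) :=
      swaps_even hab (by tauto)
    have h3 := (h _ hC1 _ (hCg _ hge) b).1 hb
    rw [hcf] at h3
    have h4 : (swap a b * swap d e)⁻¹ b = a := by
      simp only [mul_inv_rev, swap_inv, coe_mul, Function.comp, swap_apply_def]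
      grind
    rw [h4] at h3
    exact ha h3

/-- For `n ≥ 5` and a nonidentity even permutation `π`, the conjugation action of the
alternating group `A_n` on the `A_n`-conjugacy class of `π` is primitive if and only
if `n ≥ 12`, `4 ∣ n` and `π` is a fixed-point-free involution. -/
theorem primitive_alt_iff (n : ℕ) (hn : 5 ≤ n) (π : Equiv.Perm (Fin n))
    (hπA : π ∈ alternatingGroup (Fin n)) (hπ1 : π ≠ 1) :
    IsPrimitiveConjActionOf (alternatingGroup (Fin n))
        {σ : Equiv.Perm (Fin n) | ∃ g ∈ alternatingGroup (Fin n), g * π * g⁻¹ = σ} ↔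
      (12 ≤ n ∧ 4 ∣ n ∧ π ^ 2 = 1 ∧ ∀ x : Fin n, π x ≠ x) := by
  constructor
  · intro hp
    have h2 := forward_sq hn π hπA hπ1 hp
    have hf := forward_fpf hn π hπA hπ1 h2 hp
    have h2' : π ^ 2 = 1 := by
      ext1 x
      rw [pow_two]
      exact h2 x
    obtain ⟨k, hk, hc⟩ := fpf_cycleType (by omega) π h2' hf
    have hs := Equiv.Perm.sign_of_cycleType π
    rw [Equiv.Perm.mem_alternatingGroup.1 hπA, hc] at hs
    have hke : Even k := by
      by_contra hne
      rw [Nat.not_even_iff_odd] at hne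
      rw [Odd.neg_one_pow] at hs
      · exact absurd hs (by decide)
      · simp only [Multiset.sum_replicate, Multiset.card_replicate, smul_eq_mul]
        exact (even_two.mul_left k).add_odd hne
    have h4 : 4 ∣ n := by
      obtain ⟨m, hm⟩ := hke
      exact ⟨m, by omega⟩
    refine ⟨?_, h4, h2', hf⟩
    by_contra hlt
    obtain rfl : n = 8 := by omega
    exact not_prim8 π h2' hf hp
  · rintro ⟨h12, -, h2', hf⟩
    have h2 : ∀ x, π (π x) = x := by
      intro x
      have : (π ^ 2) x = x := by rw [h2']; rfl
      rwa [pow_two] at this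
    refine ⟨?_, ?_⟩
    · rintro _ ⟨g, hg, rfl⟩ _ ⟨k, hk, rfl⟩
      exact ⟨k * g⁻¹, Subgroup.mul_mem _ hk (Subgroup.inv_mem _ hg), by group⟩
    · intro r hr hsymm htr hinv
      by_cases hne : ∃ x ∈ {σ : Equiv.Perm (Fin n) | ∃ g ∈ alternatingGroup (Fin n), g * π * g⁻¹ = σ},
        ∃ y ∈ {σ : Equiv.Perm (Fin n) | ∃ g ∈ alternatingGroup (Fin n), g * π * g⁻¹ = σ},
          r x y ∧ x ≠ y
      · right
        have hCg : ∀ g ∈ alternatingGroup (Fin n), g * π * g⁻¹ ∈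
            {σ : Equiv.Perm (Fin n) | ∃ g ∈ alternatingGroup (Fin n), g * π * g⁻¹ = σ} :=
          fun g hg => ⟨g, hg, rfl⟩
        have hC1 : π ∈ {σ : Equiv.Perm (Fin n) | ∃ g ∈ alternatingGroup (Fin n), g * π * g⁻¹ = σ} :=
          ⟨1, Subgroup.one_mem _, by simp⟩
        let K : Subgroup (Equiv.Perm (Fin n)) :=
          { carrier := {g | g ∈ alternatingGroup (Fin n) ∧ r π (g * π * g⁻¹)}
            one_mem' := ⟨Subgroup.one_mem _, by simpa using hr π hC1⟩
            mul_mem' := by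
              rintro g k ⟨hg, hgr⟩ ⟨hk, hkr⟩
              have hgk := Subgroup.mul_mem _ hg hk
              refine ⟨hgk, ?_⟩
              have h3 := hinv g hg _ hC1 _ (hCg k hk) hkr
              have e : g * (k * π * k⁻¹) * g⁻¹ = g * k * π * (g * k)⁻¹ := by group
              rw [e] at h3
              exact htr _ hC1 _ (hCg g hg) _ (hCg _ hgk) hgr h3
            inv_mem' := by
              rintro g ⟨hg, hgr⟩
              have hg' := Subgroup.inv_mem _ hg
              refine ⟨hg', ?_⟩
              have h3 := hinv _ hg' _ hC1 _ (hCg g hg) hgr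
              have e : g⁻¹ * (g * π * g⁻¹) * g⁻¹⁻¹ = π := by group
              rw [e] at h3
              exact hsymm _ (hCg _ hg') _ hC1 h3 }
        obtain ⟨_, ⟨g, hg, rfl⟩, _, ⟨k, hk, rfl⟩, hxy, hxy'⟩ := hne
        have hgk := Subgroup.mul_mem _ (Subgroup.inv_mem _ hg) hk
        have hK := alt_le_of_centralizer h12 π h2 hf K
          (fun u hu huπ => ⟨hu, by rw [huπ]; simpa using hr π hC1⟩) (g⁻¹ * k)
          ⟨hgk, by
            have h3 := hinv _ (Subgroup.inv_mem _ hg) _ (hCg g hg) _ (hCg k hk) hxy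
            have e1 : g⁻¹ * (g * π * g⁻¹) * g⁻¹⁻¹ = π := by group
            have e2 : g⁻¹ * (k * π * k⁻¹) * g⁻¹⁻¹ = g⁻¹ * k * π * (g⁻¹ * k)⁻¹ := by group
            rwa [e1, e2] at h3⟩
          (by
            intro h3
            apply hxy'
            calc g * π * g⁻¹ = g * (g⁻¹ * k * π * (g⁻¹ * k)⁻¹) * g⁻¹ := by rw [h3]
              _ = _ := by group)
        rintro _ ⟨u, hu, rfl⟩ _ ⟨v, hv, rfl⟩
        exact htr _ (hCg u hu) _ hC1 _ (hCg v hv)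
          (hsymm _ hC1 _ (hCg u hu) (hK hu).2) (hK hv).2
      · left
        intro x hx y hy
        push Not at hne
        exact ⟨hne x hx y hy, fun h => h ▸ hr x hx⟩
end

section
/- For every even natural number n with n ≥ 4 and n ≠ 8, and every fixed-point-free involution π ∈ Equiv.Perm (Fin n), the intersection of the centralizer of π with the alternating group, regarded as a subgroup of alternatingGroup (Fin n) (it is isomorphic to (S_2 ≀ S_{n/2}) ∩ A_n), is a maximal proper subgroup of alternatingGroup (Fin n), i.e., a coatom in the lattice of subgroups of alternatingGroup (Fin n). -/
open Equiv Equiv.Perm MulAction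
open scoped Pointwise

namespace FpfInv

/-- `K` contains every even permutation commuting with `π`. -/
def ContainsCent {n : ℕ} (K : Subgroup (Perm (Fin n))) (π : Perm (Fin n)) : Prop :=
  ∀ f : Perm (Fin n), sign f = 1 → (∀ x, f (π x) = π (f x)) → f ∈ K

variable {n : ℕ} {K : Subgroup (Perm (Fin n))} {π : Perm (Fin n)}

lemma mem_E (hK : ContainsCent K π) (h2 : ∀ x, π (π x) = x) (hf : ∀ x, π x ≠ x)
    {x y : Fin n} (h1 : y ≠ x) (h3 : y ≠ π x) :
    swap x (π x) * swap y (π y) ∈ K := by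
  apply hK
  · rw [Perm.sign_mul, sign_swap (hf x).symm, sign_swap (hf y).symm]; rfl
  · intro z
    have := h2 x; have := h2 y; have := h2 z
    have := hf x; have := hf y; have := hf z
    simp only [Perm.mul_apply, swap_apply_def]
    grind

lemma mem_D (hK : ContainsCent K π) (h2 : ∀ x, π (π x) = x) (hf : ∀ x, π x ≠ x)
    {x y : Fin n} (h1 : y ≠ x) (h3 : y ≠ π x) :
    swap x y * swap (π x) (π y) ∈ K := by
  apply hK
  · rw [Perm.sign_mul, sign_swap h1.symm, sign_swap (fun h => h1 (π.injective h).symm)]; rfl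
  · intro z
    have := h2 x; have := h2 y; have := h2 z
    have := hf x; have := hf y; have := hf z
    simp only [Perm.mul_apply, swap_apply_def]
    grind

lemma exists_notMem (s : List (Fin n)) (h : s.length < n) : ∃ x, x ∉ s := by
  by_contra! hh
  have h1 : (Finset.univ : Finset (Fin n)) ⊆ s.toFinset := fun x _ => by simpa using hh x
  have h2 := Finset.card_le_card h1
  have h3 := s.toFinset_card_le
  simp at h2
  omega

/-- the stabilizer of `x` is transitive off `{x, π x}` -/
lemma trans_stab (hn : 6 ≤ n) (hK : ContainsCent K π) (h2 : ∀ x, π (π x) = x)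
    (hf : ∀ x, π x ≠ x) {x y z : Fin n} (hy : y ≠ x) (hy' : y ≠ π x) (hz : z ≠ x)
    (hz' : z ≠ π x) : ∃ k ∈ K, k x = x ∧ k y = z := by
  by_cases hyz : z = y
  · exact ⟨1, K.one_mem, by simp [hyz]⟩
  by_cases hyz' : z = π y
  · obtain ⟨w, hw⟩ := exists_notMem [x, π x, y, π y] (by simp; omega)
    simp at hw
    refine ⟨_, mem_E hK h2 hf (x := y) (y := w) (by tauto) (by tauto), ?_, ?_⟩
    · have := h2 x; have := h2 y; have := h2 w
      simp only [Perm.mul_apply, swap_apply_def]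
      grind
    · have := h2 x; have := h2 y; have := h2 w
      simp only [Perm.mul_apply, swap_apply_def]
      grind
  · refine ⟨_, mem_D hK h2 hf (x := y) (y := z) hyz hyz', ?_, ?_⟩
    · have := h2 x; have := h2 y; have := h2 z
      simp only [Perm.mul_apply, swap_apply_def]
      grind
    · have := h2 x; have := h2 y; have := h2 z
      have := hf y; have := hf z
      simp only [Perm.mul_apply, swap_apply_def]
      grind

lemma trans_all (hn : 6 ≤ n) (hK : ContainsCent K π) (h2 : ∀ x, π (π x) = x)
    (hf : ∀ x, π x ≠ x) (y z : Fin n) : ∃ k ∈ K, k y = z := by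
  obtain ⟨x, hx⟩ := exists_notMem [y, π y, z, π z] (by simp; omega)
  simp at hx
  obtain ⟨k, hk, -, h⟩ := trans_stab hn hK h2 hf (x := x) (y := y) (z := z) (by tauto)
    (by have := h2 x; grind) (by tauto) (by have := h2 x; grind)
  exact ⟨k, hk, h⟩

lemma block_univ (hn : 6 ≤ n) (hK : ContainsCent K π) (h2 : ∀ x, π (π x) = x)
    (hf : ∀ x, π x ≠ x) {B : Set (Fin n)} (hB : IsBlock K B) {x y : Fin n}
    (hx : x ∈ B) (hy : y ∈ B) (hxy : y ≠ x) (hxy' : y ≠ π x) : B = Set.univ := by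
  have key : ∀ {x y z : Fin n}, x ∈ B → y ∈ B → y ≠ x → y ≠ π x → z ≠ x → z ≠ π x → z ∈ B := by
    intro x y z hx hy h1 h3 h4 h5
    obtain ⟨k, hk, hkx, hky⟩ := trans_stab hn hK h2 hf h1 h3 h4 h5
    have := hB.stabilizer_le hx (show (⟨k, hk⟩ : K) ∈ stabilizer K x from hkx)
    rw [mem_stabilizer_iff] at this
    rw [← this]
    exact ⟨y, hy, hky⟩
  ext z
  simp only [Set.mem_univ, iff_true]
  by_cases hz : z = x
  · rwa [hz]
  by_cases hz' : z = π x
  · subst hz'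
    have := h2 x; have := h2 y
    exact key hy hx hxy.symm (by grind) hxy'.symm (fun h => hxy (π.injective h).symm)
  · exact key hx hy hxy hxy' hz hz'

lemma preprim (hn : 6 ≤ n) (hK : ContainsCent K π) (h2 : ∀ x, π (π x) = x)
    (hf : ∀ x, π x ≠ x) {g : Perm (Fin n)} (hg : g ∈ K) {b : Fin n}
    (hb : g (π b) ≠ π (g b)) : IsPreprimitive K (Fin n) := by
  refine { exists_smul_eq := ?_, isTrivialBlock_of_isBlock := ?_ }
  · intro x y
    obtain ⟨k, hk, h⟩ := trans_all hn hK h2 hf x y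
    exact ⟨⟨k, hk⟩, h⟩
  · intro B hB
    by_cases hs : B.Subsingleton
    · exact Or.inl hs
    right
    rw [Set.not_subsingleton_iff] at hs
    obtain ⟨x, hx, y, hy, hxy⟩ := hs
    by_cases hy' : y = π x
    · subst hy'
      by_cases hB2 : ∃ y ∈ B, y ≠ x ∧ y ≠ π x
      · obtain ⟨y, hy, h3, h4⟩ := hB2
        exact block_univ hn hK h2 hf hB hx hy h3 h4
      obtain ⟨k, hk, hkx⟩ := trans_all hn hK h2 hf x b
      by_cases hkp : k (π x) = π b
      · have hgk : g * k ∈ K := K.mul_mem hg hk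
        have := block_univ hn hK h2 hf (hB.translate ⟨g * k, hgk⟩)
          (x := g b) (y := g (π b)) ⟨x, hx, by change g (k x) = _; rw [hkx]⟩
          ⟨π x, hy, by change g (k (π x)) = _; rw [hkp]⟩
          (fun h => hf b (g.injective h)) hb
        rwa [Set.smul_set_eq_univ] at this
      · have := block_univ hn hK h2 hf (hB.translate ⟨k, hk⟩)
          (x := b) (y := k (π x)) ⟨x, hx, hkx⟩ ⟨π x, hy, rfl⟩
          (fun h => hf x (k.injective (h.trans hkx.symm))) hkp
        rwa [Set.smul_set_eq_univ] at this
    · exact block_univ hn hK h2 hf hB hx hy hxy.symm hy'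

lemma conj_contains (hK : ContainsCent K π) {g : Perm (Fin n)} (hg : g ∈ K) :
    ContainsCent K (g * π * g⁻¹) := by
  intro f hs hc
  have : g⁻¹ * f * g ∈ K := by
    apply hK
    · simp [hs]
    · intro x
      have := hc (g x)
      simp only [Perm.mul_apply, Perm.inv_def, Equiv.symm_apply_apply] at this ⊢
      rw [this, Equiv.symm_apply_apply]
  have := K.mul_mem (K.mul_mem hg this) (K.inv_mem hg)
  simpa [mul_assoc] using this

lemma comm_aux {a b c d e f h : Fin n} (hl : [a, b, c, d, e, f, h].Nodup) :
    (swap a b * swap c d) * (swap b e * swap f h) * (swap a b * swap c d) * (swap b e * swap f h)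
     = swap e a * swap e b := by
  ext x
  congr 1
  simp only [Perm.mul_apply]
  by_cases h : x ∈ [a, b, c, d, e, f, h]
  · simp only [List.nodup_cons, List.mem_cons, List.not_mem_nil] at h hl
    simp only [swap_apply_def]
    grind
  · simp only [List.nodup_cons, List.mem_cons, List.not_mem_nil] at h hl
    simp only [swap_apply_def]
    grind

/-- Large degree: a three-cycle. -/
lemma three_large (hn : 9 ≤ n) {σ : Perm (Fin n)} (hK : ContainsCent K π)
    (h2 : ∀ x, π (π x) = x) (hf : ∀ x, π x ≠ x) (hKσ : ContainsCent K σ)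
    (h2σ : ∀ x, σ (σ x) = x) (hfσ : ∀ x, σ x ≠ x) {b : Fin n} (hb : σ b ≠ π b) :
    ∃ g ∈ K, IsThreeCycle g := by
  obtain ⟨c, hc⟩ := exists_notMem [b, π b, σ b, π (σ b)] (by simp; omega)
  obtain ⟨f, hff⟩ := exists_notMem [b, σ b, π b, σ (π b), c, σ c, π c, σ (π c)] (by simp; omega)
  simp only [List.mem_cons, List.not_mem_nil, not_or] at hc hff
  have e1 := mem_E hK h2 hf (x := π b) (y := c) (by tauto) (by rw [h2]; tauto)
  have e2 := mem_E hKσ h2σ hfσ (x := b) (y := f) (by tauto) (by tauto)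
  rw [h2] at e1
  have hl : [π b, b, c, π c, σ b, f, σ f].Nodup := by
    have := h2 b; have := h2 c; have := h2 (σ b); have := hf b; have := hf c
    have := h2σ b; have := h2σ c; have := h2σ (π b); have := h2σ (π c); have := h2σ f
    have := hfσ b; have := hfσ f
    simp only [List.nodup_cons, List.mem_cons, List.not_mem_nil]
    grind
  refine ⟨_, K.mul_mem (K.mul_mem (K.mul_mem e1 e2) e1) e2, ?_⟩
  rw [comm_aux hl]
  simp only [List.nodup_cons, List.mem_cons, List.not_mem_nil, not_or] at hl
  exact isThreeCycle_swap_mul_swap_same (by tauto) (by tauto) (by tauto)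

/-- Parity of the number of inversions, for degree four. -/
def ev (f : Perm (Fin 4)) : Bool :=
  !(xor (decide (f 1 < f 0)) (xor (decide (f 2 < f 0)) (xor (decide (f 3 < f 0))
    (xor (decide (f 2 < f 1)) (xor (decide (f 3 < f 1)) (decide (f 3 < f 2)))))))

lemma ev_of_sign : ∀ f : Perm (Fin 4), sign f = 1 → ev f = true := by
  decide +kernel

set_option synthInstance.maxHeartbeats 200000 in
set_option synthInstance.maxSize 2000 in
lemma four_ev : ∀ π : Perm (Fin 4), (∀ x, π x ≠ x) → (∀ x, π (π x) = x) →
    ∀ g : Perm (Fin 4), ev g = true → (¬ ∀ x, g (π x) = π (g x)) →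
    ∀ f : Perm (Fin 4), ev f = true → (∀ x, f (π x) = π (f x)) ∨
      (∀ x, f (g (π x)) = π (f (g x))) ∨ (∀ x, f (g (g (π x))) = π (f (g (g x)))) := by
  decide +kernel

lemma four (π : Perm (Fin 4)) (hf : ∀ x, π x ≠ x) (h2 : ∀ x, π (π x) = x)
    (g : Perm (Fin 4)) (hg : sign g = 1) (hc : ¬ ∀ x, g (π x) = π (g x))
    (f : Perm (Fin 4)) (hs : sign f = 1) : (∀ x, f (π x) = π (f x)) ∨
      (∀ x, (f * g) (π x) = π ((f * g) x)) ∨ (∀ x, (f * g * g) (π x) = π ((f * g * g) x)) :=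
  four_ev π hf h2 g (ev_of_sign g hg) hc f (ev_of_sign f hs)

lemma exhaust (s : List (Fin n)) (hs : s.Nodup) (h : n ≤ s.length) (x : Fin n) : x ∈ s := by
  have h1 : s.toFinset = Finset.univ := by
    rw [← Finset.card_eq_iff_eq_univ]
    have h2 := List.toFinset_card_of_nodup hs
    have h3 := Finset.card_le_univ s.toFinset
    simp only [Fintype.card_fin] at h3 ⊢
    omega
  have : x ∈ s.toFinset := by rw [h1]; simp
  simpa using this

lemma prod_aux {a b c d e : Fin n} (hl : [a, b, c, d, e].Nodup) :
    (swap a b * swap d e) * (swap a c * swap d e) = swap a b * swap a c := by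
  ext x
  congr 1
  simp only [List.nodup_cons, List.mem_cons, List.not_mem_nil] at hl
  simp only [Perm.mul_apply, swap_apply_def]
  grind

lemma hex_apply {p q r s t u : Fin n} (hl : [p, q, r, s, t, u].Nodup) (h : Perm (Fin n))
    (hh : h = swap p r * swap r q * swap q s * swap t u) :
    h p = r ∧ h r = q ∧ h q = s ∧ h s = p ∧ h t = u ∧ h u = t := by
  subst hh
  simp only [List.nodup_cons, List.mem_cons, List.not_mem_nil] at hl
  simp only [Perm.mul_apply, swap_apply_def]
  grind

/-- Degree six: a three-cycle. -/
lemma three_six (hn : n = 6) {σ : Perm (Fin n)} (hK : ContainsCent K π)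
    (h2 : ∀ x, π (π x) = x) (hf : ∀ x, π x ≠ x) (hKσ : ContainsCent K σ)
    (h2σ : ∀ x, σ (σ x) = x) (hfσ : ∀ x, σ x ≠ x) {b : Fin n} (hb : σ b ≠ π b) :
    ∃ g ∈ K, IsThreeCycle g := by
  by_cases hA : σ (π b) = π (σ b)
  · obtain ⟨c, hc⟩ := exists_notMem [b, π b, σ b, π (σ b)] (by simp; omega)
    simp only [List.mem_cons, List.not_mem_nil, not_or] at hc
    have hl : [b, π b, σ b, π (σ b), c, π c].Nodup := by
      have := h2 b; have := h2 c; have := h2 (σ b); have := hf b; have := hf c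
      have := hf (σ b); have := hfσ b
      simp only [List.nodup_cons, List.mem_cons, List.not_mem_nil]
      grind
    have hσc : σ c = π c := by
      have hx := exhaust _ hl (by simp; omega) (σ c)
      have := h2σ b; have := h2σ (π b); have := h2σ c; have := hfσ c
      simp only [List.mem_cons, List.not_mem_nil] at hx
      grind
    have e1 := mem_E hK h2 hf (x := b) (y := c) (by tauto) (by tauto)
    have e2 := mem_E hKσ h2σ hfσ (x := b) (y := c) (by tauto) (by tauto)
    rw [hσc] at e2
    refine ⟨_, K.mul_mem e1 e2, ?_⟩
    simp only [List.nodup_cons, List.mem_cons, List.not_mem_nil, not_or] at hl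
    rw [prod_aux (by simp only [List.nodup_cons, List.mem_cons, List.not_mem_nil, not_or]; tauto)]
    exact isThreeCycle_swap_mul_swap_same (by tauto) (by tauto) (by tauto)
  · obtain ⟨a, ha⟩ : ∃ a, a = π b := ⟨_, rfl⟩
    obtain ⟨e, he⟩ : ∃ e, e = σ b := ⟨_, rfl⟩
    obtain ⟨e', he'⟩ : ∃ e', e' = π e := ⟨_, rfl⟩
    obtain ⟨c, hc⟩ : ∃ c, c = σ a := ⟨_, rfl⟩
    obtain ⟨c', hc'⟩ : ∃ c', c' = π c := ⟨_, rfl⟩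
    have pb := ha.symm
    have pa : π a = b := by rw [ha, h2]
    have pe := he'.symm
    have pe' : π e' = e := by rw [he', h2]
    have pc := hc'.symm
    have pc' : π c' = c := by rw [hc', h2]
    have sb := he.symm
    have se : σ e = b := by rw [he, h2σ]
    have sa := hc.symm
    have sc : σ c = a := by rw [hc, h2σ]
    rw [pb, sb] at hb
    rw [pb, sb, sa, pe] at hA
    clear ha he he' hc hc'
    have hl : [e', e, b, a, c, c'].Nodup := by
      have := hf b; have := hf c; have := hf e; have := hfσ b; have := hfσ a
      simp only [List.nodup_cons, List.mem_cons, List.not_mem_nil]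
      grind
    have hall := exhaust _ hl (by simp; omega)
    have sc' : σ c' = e' := by
      have hx := hall (σ c')
      have := h2σ c'; have := hfσ c'
      simp only [List.nodup_cons, List.mem_cons, List.not_mem_nil] at hx hl
      grind
    obtain ⟨h, hh⟩ : ∃ h, h = swap e' b * swap b e * swap e a * swap c c' := ⟨_, rfl⟩
    obtain ⟨q1, q2, q3, q4, q5, q6⟩ := hex_apply hl h hh
    simp only [List.nodup_cons, List.mem_cons, List.not_mem_nil, not_or] at hl
    have hhK : h ∈ K := by
      apply hK
      · rw [hh]
        simp only [Perm.sign_mul]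
        rw [sign_swap (by tauto), sign_swap (by tauto), sign_swap (by tauto),
          sign_swap (by tauto)]
        rfl
      · intro x
        have hx := hall x
        simp only [List.mem_cons, List.not_mem_nil, or_false] at hx
        rcases hx with rfl | rfl | rfl | rfl | rfl | rfl <;> grind
    -- two products of disjoint transpositions in K
    have e1 := mem_E hKσ h2σ hfσ (x := e) (y := e') (by tauto) (by rw [se]; tauto)
    have e2 := mem_E hKσ h2σ hfσ (x := e) (y := a) (by tauto) (by rw [se]; tauto)
    have se' : σ e' = c' := by rw [← sc', h2σ]
    rw [se, se'] at e1
    rw [se, sa] at e2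
    have e3 : swap a e * swap e' c' ∈ K := by
      have := K.mul_mem (K.mul_mem hhK e2) (K.inv_mem hhK)
      have h4 : h * (swap e b * swap a c) * h⁻¹ = swap (h e) (h b) * swap (h a) (h c) := by
        rw [Equiv.swap_apply_apply, Equiv.swap_apply_apply]; group
      rwa [h4, q3, q2, q4, q5] at this
    rw [swap_comm a e] at e3
    refine ⟨_, K.mul_mem e1 e3, ?_⟩
    rw [prod_aux (by simp only [List.nodup_cons, List.mem_cons, List.not_mem_nil, not_or]; tauto)]
    exact isThreeCycle_swap_mul_swap_same (by tauto) (by tauto) (by tauto)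

lemma alt_le (hn : 4 ≤ n) (heven : Even n) (hn8 : n ≠ 8) (hK : ContainsCent K π)
    (h2 : ∀ x, π (π x) = x) (hf : ∀ x, π x ≠ x) {g : Perm (Fin n)} (hg : g ∈ K)
    (hgs : sign g = 1) (hb : ¬ ∀ x, g (π x) = π (g x)) : alternatingGroup (Fin n) ≤ K := by
  by_cases h4 : n = 4
  · subst h4
    intro f hfA
    rcases four π hf h2 g hgs hb f hfA with h | h | h
    · exact hK _ hfA h
    · have := hK _ (by rw [Perm.sign_mul, hgs, show sign f = 1 from hfA]; rfl) h
      exact (K.mul_mem_cancel_right hg).1 this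
    · have := hK _ (by rw [Perm.sign_mul, Perm.sign_mul, hgs, show sign f = 1 from hfA]; rfl) h
      exact (K.mul_mem_cancel_right hg).1 ((K.mul_mem_cancel_right hg).1 this)
  have hn6 : 6 ≤ n := by
    obtain ⟨m, hm⟩ := heven; omega
  push Not at hb
  obtain ⟨b, hb⟩ := hb
  have hp := preprim hn6 hK h2 hf hg hb
  have hKσ := conj_contains hK hg
  have h2σ : ∀ x, (g * π * g⁻¹) ((g * π * g⁻¹) x) = x := by
    intro x
    simp [Perm.mul_apply, h2]
  have hfσ : ∀ x, (g * π * g⁻¹) x ≠ x := by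
    intro x hx
    apply hf (g⁻¹ x)
    apply g.injective
    simpa [Perm.mul_apply] using hx
  have hbσ : (g * π * g⁻¹) (g b) ≠ π (g b) := by
    simpa [Perm.mul_apply] using hb
  obtain ⟨t, ht, ht3⟩ : ∃ t ∈ K, IsThreeCycle t := by
    by_cases h6 : n = 6
    · exact three_six h6 hK h2 hf hKσ h2σ hfσ hbσ
    · refine three_large ?_ hK h2 hf hKσ h2σ hfσ hbσ
      obtain ⟨m, hm⟩ := heven; omega
  exact alternatingGroup_le_of_isPreprimitive_of_isThreeCycle_mem hp ht3 ht

lemma exists_noncomm (hn : 4 ≤ n) (h2 : ∀ x, π (π x) = x) (hf : ∀ x, π x ≠ x) :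
    ∃ f : Perm (Fin n), sign f = 1 ∧ ¬ ∀ x, f (π x) = π (f x) := by
  let b : Fin n := ⟨0, by omega⟩
  obtain ⟨c, hc⟩ := exists_notMem [b, π b] (by simp; omega)
  simp only [List.mem_cons, List.not_mem_nil, not_or] at hc
  refine ⟨swap b (π b) * swap b c, ?_, ?_⟩
  · rw [Perm.sign_mul, sign_swap (hf b).symm, sign_swap (Ne.symm hc.1)]; rfl
  · intro h
    have h1 := h c
    have := h2 b; have := h2 c; have := hf b; have := hf c
    simp only [Perm.mul_apply, swap_apply_def] at h1
    grind

end FpfInv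

/-- For even `n ≥ 4` with `n ≠ 8` and a fixed-point-free involution `π ∈ S_n`, the
intersection of the centralizer of `π` with the alternating group, viewed as a
subgroup of `alternatingGroup (Fin n)` (isomorphic to `(S_2 ≀ S_{n/2}) ∩ A_n`), is a
maximal subgroup of `alternatingGroup (Fin n)`, i.e. a coatom in its subgroup
lattice. -/
theorem centralizer_fpf_involution_maximal_alt (n : ℕ) (hn : 4 ≤ n) (heven : Even n)
    (hn8 : n ≠ 8)
    (π : Equiv.Perm (Fin n)) (hπ1 : π ≠ 1) (hπ2 : π ^ 2 = 1)
    (hfpf : ∀ x : Fin n, π x ≠ x) :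
    IsCoatom ((Subgroup.centralizer {π}).subgroupOf (alternatingGroup (Fin n))) := by
  have h2 : ∀ x, π (π x) = x := fun x => by
    have := congrArg (fun f : Equiv.Perm (Fin n) => f x) hπ2
    simpa [sq] using this
  have hcent : ∀ f : Equiv.Perm (Fin n), f ∈ Subgroup.centralizer {π} ↔
      ∀ x, f (π x) = π (f x) := by
    intro f
    rw [Subgroup.mem_centralizer_singleton_iff, Equiv.ext_iff]
    constructor
    · intro h x
      simpa using h x
    · intro h x
      simpa using h x
  constructor
  · intro htop
    obtain ⟨f, hs, hfc⟩ := FpfInv.exists_noncomm hn h2 hfpf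
    rw [Subgroup.subgroupOf_eq_top] at htop
    exact hfc ((hcent f).1 (htop hs))
  · intro L hL
    obtain ⟨hle, ⟨g, hgA⟩, hgL, hgH⟩ := SetLike.lt_iff_le_and_exists.1 hL
    have hK : FpfInv.ContainsCent (L.map (alternatingGroup (Fin n)).subtype) π := by
      intro f hs hc
      exact ⟨⟨f, hs⟩, hle (Subgroup.mem_subgroupOf.2 ((hcent f).2 hc)), rfl⟩
    have := FpfInv.alt_le hn heven hn8 hK h2 hfpf (g := g) ⟨⟨g, hgA⟩, hgL, rfl⟩ hgA
      (fun h => hgH (Subgroup.mem_subgroupOf.2 ((hcent g).2 h)))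
    rw [eq_top_iff]
    rintro ⟨f, hfA⟩ -
    obtain ⟨f', hf', hff⟩ := this hfA
    have : f' = ⟨f, hfA⟩ := Subtype.ext hff
    rwa [← this]
end
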